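/- arXiv:1308.5522 — 2 statements merged into one kernel-verified Lean document; each statement's English description precedes it below -/
import Mathlib

section
/- Let Y be a set, Z ⊆ Y, and f : Y → ℝ. Suppose f restricted to Z attains a minimum value μ_Z, attained exactly on the nonempty set M_Z ⊆ Z. Let (A, ≼) be a partially ordered set and (Y_α)_{α∈A} a family of subsets of Y with Y = ⋃_{α∈A} Y_α, such that for every α ∈ A the set {α' ∈ A : α' ≺ α and Y_{α'} ⊄ Z} is finite. Suppose F : Y → 𝒫(Y) satisfies: (1) F(y) = ∅ if and only if y ∈ Z; (2) if y' ∈ F(y) then f(y') ≤ f(y); (3) if y ∈ Y_α and y' ∈ F(y), then y' ∈ Y_{α'} for some α' ≺ α. Then f attains a minimum on Y and this minimum equals μ_Z. If moreover F(y) ∩ M_Z ≠ ∅ implies μ_Z < f(y), then the set of minimizers of f on Y equals M_Z. -/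
/-- Induction principle for an index-decreasing set-valued map: a property that holds on the
terminal set `Z` and propagates backwards along `F` holds everywhere. -/
theorem induction_of_index_decreasing {Y A : Type*} [PartialOrder A] {Z : Set Y}
    {Yfam : A → Set Y} (hcover : ∀ y : Y, ∃ α : A, y ∈ Yfam α)
    (hfin : ∀ α : A, {α' : A | α' < α ∧ ¬ Yfam α' ⊆ Z}.Finite) {F : Y → Set Y}
    (hF : ∀ y ∉ Z, (F y).Nonempty)
    (hdec : ∀ (α : A) (y y' : Y), y ∈ Yfam α → y' ∈ F y → ∃ α' < α, y' ∈ Yfam α')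
    {P : Y → Prop} (base : ∀ y ∈ Z, P y)
    (step : ∀ y ∉ Z, ∀ y' ∈ F y, P y' → P y) (y : Y) : P y := by
  obtain ⟨α, hα⟩ := hcover y
  induction hn : {α' : A | α' < α ∧ ¬ Yfam α' ⊆ Z}.ncard using Nat.strong_induction_on
    generalizing α y with
  | _ n ih =>
    subst hn
    by_cases hy : y ∈ Z
    · exact base y hy
    obtain ⟨y', hy'⟩ := hF y hy
    refine step y hy y' hy' ?_
    by_cases hyZ : y' ∈ Z
    · exact base y' hyZ
    obtain ⟨β, hβα, hβ⟩ := hdec α y y' hα hy'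
    have hss : {α' : A | α' < β ∧ ¬ Yfam α' ⊆ Z} ⊂ {α' : A | α' < α ∧ ¬ Yfam α' ⊆ Z} :=
      ⟨fun γ hγ => ⟨hγ.1.trans hβα, hγ.2⟩,
        fun h => lt_irrefl β (h ⟨hβα, fun hsub => hyZ (hsub hβ)⟩).1⟩
    exact ih _ (Set.ncard_lt_ncard hss (hfin α)) y' β hβ rfl


/-- abstract optimization algorithm, after Zangwill. Given `Z ⊆ Y`,
`f : Y → ℝ` whose restriction to `Z` attains the minimum `μZ` exactly on the nonempty set
`MZ ⊆ Z`, a covering family `(Yfam α)` over a poset `A` such that below any index only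
finitely many indices carry sets not contained in `Z`, and a set-valued map `F` with
`F y = ∅ ↔ y ∈ Z`, non-increasing values of `f` along `F`, and strictly decreasing index
along `F`, then `f` attains the minimum `μZ` on `Y`; if moreover `F y ∩ MZ ≠ ∅` implies
`μZ < f y`, then the set of minimizers of `f` on `Y` is exactly `MZ`. -/
theorem stmt_18 {Y : Type*} {A : Type*} [PartialOrder A]
    (Z : Set Y) (f : Y → ℝ) (μZ : ℝ) (MZ : Set Y)
    (hMZ : MZ = {y ∈ Z | f y = μZ}) (hMZne : MZ.Nonempty)
    (hμZ : ∀ y ∈ Z, μZ ≤ f y)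
    (Yfam : A → Set Y) (hcover : ∀ y : Y, ∃ α : A, y ∈ Yfam α)
    (hfin : ∀ α : A, {α' : A | α' < α ∧ ¬ Yfam α' ⊆ Z}.Finite)
    (F : Y → Set Y)
    (h1 : ∀ y : Y, F y = ∅ ↔ y ∈ Z)
    (h2 : ∀ y y' : Y, y' ∈ F y → f y' ≤ f y)
    (h3 : ∀ (α : A) (y y' : Y), y ∈ Yfam α → y' ∈ F y → ∃ α' < α, y' ∈ Yfam α') :
    (∀ y : Y, μZ ≤ f y) ∧ (∃ y : Y, f y = μZ) ∧
      ((∀ y : Y, (F y ∩ MZ).Nonempty → μZ < f y) → {y : Y | f y = μZ} = MZ) := by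
  have hF : ∀ y ∉ Z, (F y).Nonempty := fun y hy =>
    Set.nonempty_iff_ne_empty.2 fun h => hy ((h1 y).1 h)
  have hmin : ∀ y : Y, μZ ≤ f y :=
    induction_of_index_decreasing hcover hfin hF h3 hμZ
      fun y _ y' hy' h => h.trans (h2 y y' hy')
  subst hMZ
  obtain ⟨z, -, hfz⟩ := hMZne
  refine ⟨hmin, ⟨z, hfz⟩, fun hstrict => ?_⟩
  have hlt : ∀ y : Y, y ∉ Z → μZ < f y := by
    refine induction_of_index_decreasing hcover hfin hF h3 (fun y hy h => absurd hy h) ?_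
    intro y _ y' hy' ih _
    by_cases hZ : y' ∈ Z
    · rcases (hμZ y' hZ).eq_or_lt with h | h
      · exact hstrict y ⟨y', hy', hZ, h.symm⟩
      · exact h.trans_le (h2 y y' hy')
    · exact (ih hZ).trans_le (h2 y y' hy')
  ext y
  exact ⟨fun hy => ⟨by_contra fun h => (hlt y h).ne' hy, hy⟩, fun hy => hy.2⟩
end

section
/- Let N : ℝⁿ → ℝ be a norm such that at every point p ∈ ℝⁿ \ {0} at which N is Fréchet differentiable, its derivative — identified with a vector in ℝⁿ via the standard inner product — belongs to ℤⁿ. Then the unit ball {x ∈ ℝⁿ : N(x) ≤ 1} of N is a polytope, i.e., the convex hull of a finite set of points. -/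
/-- A one-sided linear upper bound along a direction bounds the directional derivative. -/
lemma HasFDerivAt.apply_le_of_forall_add_smul_le {E : Type*} [NormedAddCommGroup E]
    [NormedSpace ℝ E] {f : E → ℝ} {D : E →L[ℝ] ℝ} {p v : E} {c : ℝ} (h : HasFDerivAt f D p)
    (hc : ∀ t : ℝ, 0 < t → t < 1 → f (p + t • v) ≤ f p + t * c) : D v ≤ c := by
  have hlim := (h.hasLineDerivAt v).tendsto_slope_zero_right
  refine le_of_tendsto hlim ?_
  filter_upwards [Ioo_mem_nhdsGT (zero_lt_one : (0 : ℝ) < 1)] with t ht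
  have := hc t ht.1 ht.2
  rw [smul_eq_mul, inv_mul_le_iff₀ ht.1]
  linarith

/-- A polyhedron, given by finitely many linear inequalities, has finitely many extreme points. -/
lemma finite_extremePoints_polyhedron {E : Type*} [AddCommGroup E] [Module ℝ E]
    {M : Set (E →ₗ[ℝ] ℝ)} (hM : M.Finite) :
    (Set.extremePoints ℝ {x : E | ∀ m ∈ M, m x ≤ 1}).Finite := by
  refine Set.Finite.of_finite_image (f := fun x => {m ∈ M | m x = 1})
    (hM.finite_subsets.subset ?_) ?_
  · rintro _ ⟨x, -, rfl⟩
    exact Set.sep_subset _ _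
  · intro x hx y hy hxy
    by_contra hne
    have key : ∀ m ∈ M, ∀ᶠ t : ℝ in nhdsWithin 0 (Set.Ioi 0), m (x + t • (x - y)) ≤ 1 := by
      intro m hm
      by_cases h1 : m x = 1
      · have h2 : m y = 1 := ((Set.ext_iff.1 hxy m).1 ⟨hm, h1⟩).2
        refine Filter.Eventually.of_forall fun t => ?_
        simp [h1, h2]
      · have hlt : m x < 1 := lt_of_le_of_ne (hx.1 m hm) h1
        have hcont : Continuous fun t : ℝ => m x + t * (m x - m y) := by fun_prop
        have := (hcont.tendsto 0).eventually_lt_const (u := 1) (by simpa using hlt)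
        filter_upwards [nhdsWithin_le_nhds this] with t ht
        simpa using ht.le
    obtain ⟨t, ht, ht0⟩ := (((Filter.eventually_all_finite hM).2 key).and
      self_mem_nhdsWithin).exists
    have ht0 : 0 < t := ht0
    refine hne (hx.2 (x₁ := y) hy.1 ht ?_).symm
    refine ⟨t / (1 + t), 1 / (1 + t), by positivity, by positivity, by field_simp; ring, ?_⟩
    have : (1 + t) ≠ 0 := by positivity
    match_scalars <;> field_simp
    ring

/-- A compact polyhedron is the convex hull of a finite set. -/
lemma exists_finset_convexHull_eq_polyhedron {E : Type*} [NormedAddCommGroup E]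
    [NormedSpace ℝ E] [FiniteDimensional ℝ E] {M : Set (E →ₗ[ℝ] ℝ)} (hM : M.Finite)
    (hc : IsCompact {x : E | ∀ m ∈ M, m x ≤ 1}) :
    ∃ S : Finset E, {x : E | ∀ m ∈ M, m x ≤ 1} = convexHull ℝ (S : Set E) := by
  have hfin := finite_extremePoints_polyhedron hM
  have hconv : Convex ℝ {x : E | ∀ m ∈ M, m x ≤ 1} := by
    simp only [Set.ofPred_forall]
    exact convex_iInter₂ fun m _ => convex_halfSpace_le m.isLinear 1
  refine ⟨hfin.toFinset, ?_⟩
  rw [hfin.coe_toFinset, ← (hfin.isCompact_convexHull (𝕜 := ℝ)).isClosed.closure_eq]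
  exact (closure_convexHull_extremePoints hc hconv).symm

/-- If `N` is a norm on `ℝⁿ` whose Fréchet derivative, wherever it exists
away from the origin and identified with a vector via the standard inner product, is an
integer vector, then the unit ball of `N` is a polytope. -/
theorem stmt_19 (n : ℕ) (N : (Fin n → ℝ) → ℝ)
    (hpos : ∀ x : Fin n → ℝ, x ≠ 0 → 0 < N x)
    (hhom : ∀ (c : ℝ) (x : Fin n → ℝ), 0 ≤ c → N (c • x) = c * N x)
    (hsymm : ∀ x : Fin n → ℝ, N (-x) = N x)
    (hsub : ∀ x y : Fin n → ℝ, N (x + y) ≤ N x + N y)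
    (hderiv : ∀ p : Fin n → ℝ, p ≠ 0 →
      ∀ D : (Fin n → ℝ) →L[ℝ] ℝ, HasFDerivAt N D p →
        ∃ m : Fin n → ℤ, ∀ x : Fin n → ℝ, D x = ∑ i, (m i : ℝ) * x i) :
    ∃ S : Finset (Fin n → ℝ), {x : Fin n → ℝ | N x ≤ 1} = convexHull ℝ (S : Set (Fin n → ℝ)) := by
  have h0 : N 0 = 0 := by simpa using hhom 0 0 le_rfl
  have habs (c : ℝ) (x : Fin n → ℝ) : N (c • x) = |c| * N x := by
    rcases le_total 0 c with hc | hc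
    · rw [abs_of_nonneg hc, hhom c x hc]
    · rw [abs_of_nonpos hc, ← hhom (-c) x (by linarith), neg_smul, hsymm]
  let p : Seminorm ℝ (Fin n → ℝ) := Seminorm.of N hsub habs
  -- `N` is Lipschitz.
  obtain ⟨C, hC⟩ : ∃ C : NNReal, LipschitzWith C N := by
    refine ⟨_, LipschitzWith.of_le_add_mul' (∑ i, N (Pi.single i (1 : ℝ))) fun x y => ?_⟩
    have hb (z : Fin n → ℝ) : N z ≤ (∑ i, N (Pi.single i (1 : ℝ))) * ‖z‖ := by
      calc N z = N (∑ i, z i • Pi.single i (1 : ℝ)) := by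
            rw [← pi_eq_sum_univ' z]
        _ ≤ ∑ i, N (z i • Pi.single i (1 : ℝ)) := Finset.le_sum_of_subadditive N h0.le hsub _ _
        _ ≤ ∑ i, N (Pi.single i (1 : ℝ)) * ‖z‖ := by
            refine Finset.sum_le_sum fun i _ => ?_
            rw [habs, mul_comm]
            exact mul_le_mul_of_nonneg_left (norm_le_pi_norm z i) (apply_nonneg p _)
        _ = _ := by rw [Finset.sum_mul]
    have h1 := hsub y (x - y)
    rw [add_sub_cancel] at h1
    rw [dist_eq_norm]
    exact h1.trans (add_le_add_right (hb (x - y)) _)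
  have hcont := hC.continuous
  -- The unit ball is compact.
  have hcomp : IsCompact {x : Fin n → ℝ | N x ≤ 1} := by
    obtain ⟨a, ha, hle⟩ := (isCompact_sphere (0 : Fin n → ℝ) 1).exists_forall_le'
      hcont.continuousOn (a := 0) fun x hx => hpos x (by rintro rfl; simp at hx)
    refine Metric.isCompact_of_isClosed_isBounded (isClosed_le hcont continuous_const) ?_
    refine isBounded_iff_forall_norm_le.2 ⟨a⁻¹, fun x hx => ?_⟩
    rcases eq_or_ne x 0 with rfl | hx0
    · simpa using ha.le
    · have h2 := hle (‖x‖⁻¹ • x) (by simp [norm_smul, hx0])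
      have hxp := norm_pos_iff.2 hx0
      rw [hhom _ _ (by positivity), le_inv_mul_iff₀ hxp] at h2
      rw [← one_div, le_div_iff₀ ha]
      exact h2.trans hx
  -- The integer vectors of dual norm at most one.
  let L (m : Fin n → ℤ) : (Fin n → ℝ) →ₗ[ℝ] ℝ := ∑ i, (m i : ℝ) • LinearMap.proj i
  have hL (m : Fin n → ℤ) (x : Fin n → ℝ) : L m x = ∑ i, (m i : ℝ) * x i := by simp [L]
  let A : Set (Fin n → ℤ) := {m | ∀ x, L m x ≤ N x}
  have hA : A.Finite := by
    refine (Set.finite_Icc (fun i => -⌊N (Pi.single i 1)⌋) fun i => ⌊N (Pi.single i 1)⌋).subset ?_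
    intro m hm
    refine ⟨fun i => ?_, fun i => ?_⟩
    · have := hm (-Pi.single i 1)
      rw [hsymm, map_neg, hL] at this
      rw [neg_le, Int.le_floor]
      simpa [Pi.single_apply] using this
    · have := hm (Pi.single i 1)
      rw [hL] at this
      rw [Int.le_floor]
      simpa [Pi.single_apply] using this
  have hLcont (m : Fin n → ℤ) : Continuous (L m) := (L m).continuous_of_finiteDimensional
  have hclosed : IsClosed (⋃ m ∈ A, {x | N x ≤ L m x}) :=
    hA.isClosed_biUnion fun m _ => isClosed_le hcont (hLcont m)
  -- By Rademacher's theorem `N` is differentiable on a dense set.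
  have hdense : Dense {x | DifferentiableAt ℝ N x} :=
    MeasureTheory.Measure.dense_of_ae (μ := MeasureTheory.volume) hC.ae_differentiableAt
  have hdiff : {x | 1 < N x} ∩ {x | DifferentiableAt ℝ N x} ⊆ ⋃ m ∈ A, {x | N x ≤ L m x} := by
    rintro q ⟨hq1, hqd⟩
    have hq1 : 1 < N q := hq1
    have hq0 : q ≠ 0 := by
      rintro rfl
      linarith
    have hD : HasFDerivAt N (fderiv ℝ N q) q := DifferentiableAt.hasFDerivAt hqd
    obtain ⟨m, hm⟩ := hderiv q hq0 _ hD
    refine Set.mem_biUnion (x := m) (fun x => ?_) ?_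
    · rw [hL, ← hm]
      refine hD.apply_le_of_forall_add_smul_le fun t ht _ => ?_
      rw [← hhom t x ht.le]
      exact hsub _ _
    · have h3 : fderiv ℝ N q (-q) ≤ -N q := by
        refine hD.apply_le_of_forall_add_smul_le fun t _ ht => ?_
        rw [show q + t • -q = (1 - t) • q by module, hhom _ _ (by linarith)]
        linarith
      rw [map_neg, hm, ← hL] at h3
      exact neg_le_neg_iff.1 h3
  have hball : {x : Fin n → ℝ | N x ≤ 1} = {x | ∀ l ∈ L '' A, l x ≤ 1} := by
    ext x
    simp only [Set.mem_ofPred_eq, Set.forall_mem_image]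
    refine ⟨fun hx m hm => (hm x).trans hx, fun hx => ?_⟩
    by_contra! hlt
    have hmem := closure_minimal hdiff hclosed <|
      hdense.open_subset_closure_inter (isOpen_lt continuous_const hcont) hlt
    obtain ⟨m, hm, hle⟩ := Set.mem_iUnion₂.1 hmem
    exact absurd (hle.trans (hx hm)) hlt.not_ge
  rw [hball] at hcomp ⊢
  exact exists_finset_convexHull_eq_polyhedron (hA.image L) hcomp
end
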